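/- Let G be a plane triangulation and let u, v, w be three pairwise adjacent vertices of G such that the triangle uvw is not a face of G (i.e., neither cyclic orientation of its three darts is an orbit of the face permutation). Then deg u + deg v + deg w ≥ 18, or G contains a vertex of degree 3. -/

import Mathlib

open SimpleGraph

variable {V : Type}

/-- The involution of the darts of a graph reversing each dart. -/
def dartRev (G : SimpleGraph V) : Equiv.Perm G.Dart :=
  Function.Involutive.toPerm SimpleGraph.Dart.symm SimpleGraph.Dart.symm_involutive

/-- The face permutation of a rotation system `σ`: it sends a dart `(u,v)` to `σ (v,u)`. -/
def facePerm {G : SimpleGraph V} (σ : Equiv.Perm G.Dart) : Equiv.Perm G.Dart :=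
  (dartRev G).trans σ

/-- The setoid on `α` whose classes are the orbits (cycles) of a permutation of `α`. -/
def orbitSetoid {α : Type*} (f : Equiv.Perm α) : Setoid α :=
  ⟨f.SameCycle, ⟨fun x => Equiv.Perm.SameCycle.refl f x, fun h => h.symm, fun h h' => h.trans h'⟩⟩

/-- The number of faces of a rotation system: the number of orbits of the face permutation. -/
noncomputable def numFaces {G : SimpleGraph V} (σ : Equiv.Perm G.Dart) : ℕ :=
  Nat.card (Quotient (orbitSetoid (facePerm σ)))

/-- The number of darts in the face (orbit of the face permutation) containing the dart `d`. -/
noncomputable def faceSize {G : SimpleGraph V} (σ : Equiv.Perm G.Dart) (d : G.Dart) : ℕ :=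
  Nat.card {e : G.Dart // (facePerm σ).SameCycle d e}

/-- `σ` is a rotation system on `G`: every dart and its image share their first vertex, and
the `σ`-orbit of every dart consists of all darts sharing its first vertex. -/
structure IsRotationSystem (G : SimpleGraph V) (σ : Equiv.Perm G.Dart) : Prop where
  fst_eq : ∀ d : G.Dart, (σ d).toProd.1 = d.toProd.1
  orbit_eq : ∀ d e : G.Dart, d.toProd.1 = e.toProd.1 → σ.SameCycle d e

/-- The degree of a vertex. -/
noncomputable def deg (G : SimpleGraph V) (v : V) : ℕ := Nat.card (G.neighborSet v)

/-- A plane triangulation: a finite connected simple graph on at least 4 vertices equipped with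
a rotation system satisfying Euler's formula `|V| - |E| + F = 2` in which every face consists of
exactly 3 darts. -/
structure IsPlaneTriangulation [Fintype V] (G : SimpleGraph V) (σ : Equiv.Perm G.Dart) :
    Prop where
  connected : G.Connected
  four_le_card : 4 ≤ Fintype.card V
  rot : IsRotationSystem G σ
  euler : Fintype.card V + numFaces σ = Nat.card G.edgeSet + 2
  face_size_eq : ∀ d : G.Dart, faceSize σ d = 3

/-- A proper 5-coloring (colors `0,...,4` standing for `1,...,5`). -/
def Proper5 (G : SimpleGraph V) (c : V → Fin 5) : Prop :=
  ∀ ⦃u w : V⦄, G.Adj u w → c u ≠ c w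

/-- A finite simple graph is planar if it is isomorphic to a subgraph of a plane triangulation. -/
def IsPlanar [Fintype V] (G : SimpleGraph V) : Prop :=
  ∃ (W : Type) (iW : Fintype W) (T : SimpleGraph W) (σ : Equiv.Perm T.Dart),
    @IsPlaneTriangulation W iW T σ ∧ ∃ f : G →g T, Function.Injective f

/-- `w` is the neighbor of `v` following `u` in the cyclic (counterclockwise) order
around `v` given by the rotation system `σ`. -/
def NextNbr {G : SimpleGraph V} (σ : Equiv.Perm G.Dart) (v u w : V) : Prop :=
  ∃ h : G.Adj v u, (σ ⟨(v, u), h⟩).toProd.2 = w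

/-- A minimal counterexample: a plane triangulation admitting no proper 5-coloring with some
color class of size at most `|V|/6`, while every planar graph on fewer vertices admits one. -/
def IsMinimalCounterexample [Fintype V] (G : SimpleGraph V) (σ : Equiv.Perm G.Dart) : Prop :=
  IsPlaneTriangulation G σ ∧
  (¬ ∃ c : V → Fin 5, Proper5 G c ∧
      ∃ k : Fin 5, 6 * Nat.card {v : V | c v = k} ≤ Fintype.card V) ∧
  (∀ (W : Type) [Fintype W] (H : SimpleGraph W), IsPlanar H →
      Fintype.card W < Fintype.card V →
      ∃ c : W → Fin 5, Proper5 H c ∧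
        ∃ k : Fin 5, 6 * Nat.card {w : W | c w = k} ≤ Fintype.card W)

/-- `w` is reached from `v` after `n` steps of the rotation around `u`. -/
def StepsTo {G : SimpleGraph V} (σ : Equiv.Perm G.Dart) (u : V) : ℕ → V → V → Prop
  | 0, v, w => v = w
  | n + 1, v, w => ∃ x, NextNbr σ u v x ∧ StepsTo σ u n x w

section helpers
variable {G : SimpleGraph V} {σ : Equiv.Perm G.Dart}

theorem nextNbr_iff (hr : IsRotationSystem G σ) {a b c : V} :
    NextNbr σ a b c ↔ ∃ (h : G.Adj a b) (h' : G.Adj a c), σ ⟨(a, b), h⟩ = ⟨(a, c), h'⟩ := by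
  constructor
  · rintro ⟨h, e⟩
    have h1 := hr.fst_eq ⟨(a, b), h⟩
    have h2 := (σ ⟨(a, b), h⟩).adj
    have e1 : (σ ⟨(a, b), h⟩).toProd = (a, c) := Prod.ext h1 e
    refine ⟨h, ?_, SimpleGraph.Dart.ext _ _ e1⟩
    rw [e1] at h2
    exact h2
  · rintro ⟨h, h', e⟩
    exact ⟨h, by rw [e]⟩

theorem face_cube [Fintype V] (hT : IsPlaneTriangulation G σ) (d : G.Dart) :
    facePerm σ (facePerm σ (facePerm σ d)) = d := by
  classical
  have h := hT.face_size_eq d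
  have hc : (facePerm σ ^ 3) d = d := by
    by_cases hfix : facePerm σ d = d
    · simp [pow_succ, hfix]
    · have hcard : ((facePerm σ).cycleOf d).support.card = 3 := by
        rw [← h, faceSize, Nat.card_eq_fintype_card, Fintype.card_subtype]
        congr 1
        ext e
        rw [Equiv.Perm.mem_support_cycleOf_iff' hfix]
        simp
      have := Equiv.Perm.pow_mod_card_support_cycleOf_self_apply (facePerm σ) 3 d
      rw [hcard] at this
      simpa using this.symm
  simpa [pow_succ] using hc

theorem facePerm_mk (a b : V) (h : G.Adj a b) :
    facePerm σ ⟨(a, b), h⟩ = σ ⟨(b, a), h.symm⟩ := rfl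

theorem nextNbr_rot [Fintype V] (hT : IsPlaneTriangulation G σ) {a b c : V}
    (h : NextNbr σ a b c) : NextNbr σ c a b := by
  obtain ⟨h1, h2, e⟩ := (nextNbr_iff hT.rot).1 h
  have h3 := face_cube hT ⟨(b, a), h1.symm⟩
  rw [facePerm_mk b a, e, facePerm_mk a c] at h3
  have h4 : NextNbr σ c a (σ ⟨(c, a), h2.symm⟩).toProd.2 := ⟨h2.symm, rfl⟩
  obtain ⟨h5, h6, e'⟩ := (nextNbr_iff hT.rot).1 h4
  rw [e', facePerm_mk c] at h3
  have h7 := hT.rot.fst_eq ⟨((σ ⟨(c, a), h2.symm⟩).toProd.2, c), h6.symm⟩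
  rw [h3] at h7
  have h8 : b = (σ ⟨(c, a), h2.symm⟩).toProd.2 := h7
  rw [← h8] at h4
  exact h4

theorem nextNbr_fun {a b c c' : V} (h : NextNbr σ a b c) (h' : NextNbr σ a b c') : c = c' := by
  obtain ⟨_, e⟩ := h
  obtain ⟨_, e'⟩ := h'
  exact e.symm.trans e'

theorem nextNbr_inj (hr : IsRotationSystem G σ) {a b b' c : V}
    (h : NextNbr σ a b c) (h' : NextNbr σ a b' c) : b = b' := by
  obtain ⟨_, _, e⟩ := (nextNbr_iff hr).1 h
  obtain ⟨_, _, e'⟩ := (nextNbr_iff hr).1 h'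
  have := σ.injective (e.trans e'.symm)
  simpa using this

theorem nextNbr_adj [Fintype V] (hT : IsPlaneTriangulation G σ) {a b c : V}
    (h : NextNbr σ a b c) : G.Adj b c :=
  (nextNbr_rot hT (nextNbr_rot hT h)).1

theorem stepsTo_iff (hr : IsRotationSystem G σ) (u : V) (n : ℕ) :
    ∀ {v w : V} (h : G.Adj u v) (h' : G.Adj u w),
    (σ ^ n) ⟨(u, v), h⟩ = ⟨(u, w), h'⟩ → StepsTo σ u n v w := by
  induction n with
  | zero => intro v w h h' e; simpa [StepsTo] using e
  | succ n ih =>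
    intro v w h h' e
    have h4 : NextNbr σ u v (σ ⟨(u, v), h⟩).toProd.2 := ⟨h, rfl⟩
    obtain ⟨_, h6, e'⟩ := (nextNbr_iff hr).1 h4
    refine ⟨_, h4, ih h6 h' ?_⟩
    rw [← e', ← e, pow_succ]
    rfl

theorem deg_three [Fintype V] (hT : IsPlaneTriangulation G σ) {z a b c : V}
    (h1 : NextNbr σ z a b) (h2 : NextNbr σ z b c) (h3 : NextNbr σ z c a) : deg G z = 3 := by
  classical
  have hab := (nextNbr_adj hT h1).ne
  have hbc := (nextNbr_adj hT h2).ne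
  have hca := (nextNbr_adj hT h3).ne
  have key : ∀ n x y, (x = a ∨ x = b ∨ x = c) → StepsTo σ z n x y →
      (y = a ∨ y = b ∨ y = c) := by
    intro n
    induction n with
    | zero => intro x y hx hy; exact hy ▸ hx
    | succ n ih =>
      rintro x y hx ⟨t, ht, hs⟩
      refine ih t y ?_ hs
      rcases hx with rfl | rfl | rfl
      · exact Or.inr (Or.inl (nextNbr_fun ht h1))
      · exact Or.inr (Or.inr (nextNbr_fun ht h2))
      · exact Or.inl (nextNbr_fun ht h3)
  have hset : G.neighborSet z = (({a, b, c} : Finset V) : Set V) := by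
    ext y
    simp only [SimpleGraph.mem_neighborSet, Finset.coe_insert, Finset.coe_singleton,
      Set.mem_insert_iff, Set.mem_singleton_iff]
    constructor
    · intro hy
      obtain ⟨i, -, hi⟩ := (hT.rot.orbit_eq ⟨(z, a), h1.1⟩ ⟨(z, y), hy⟩ rfl).exists_pow_eq'
      exact key i a y (Or.inl rfl) (stepsTo_iff hT.rot z i _ _ hi)
    · rintro (rfl | rfl | rfl)
      · exact h1.1
      · exact h2.1
      · exact h3.1
  rw [deg, hset, Nat.card_coe_set_eq, Set.ncard_coe_finset]
  exact Finset.card_eq_three.2 ⟨a, b, c, hab, hca.symm, hbc, rfl⟩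

theorem exists_steps [Fintype V] (hT : IsPlaneTriangulation G σ) {u v w : V}
    (h : G.Adj u v) (h' : G.Adj u w) (hne : v ≠ w) :
    ∃ m n : ℕ, 1 ≤ m ∧ 1 ≤ n ∧ m + n ≤ deg G u ∧ StepsTo σ u m v w ∧ StepsTo σ u n w v := by
  classical
  have hs := hT.rot.orbit_eq ⟨(u, v), h⟩ ⟨(u, w), h'⟩ rfl
  have hsupp : (⟨(u, v), h⟩ : G.Dart) ∈ σ.support := by
    rw [Equiv.Perm.mem_support]
    intro hfix
    have h1 := hs.eq_of_left hfix
    simp at h1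
    exact hne h1
  obtain ⟨i, hi, e⟩ := hs.exists_pow_eq_of_mem_support hsupp
  set k := (σ.cycleOf ⟨(u, v), h⟩).support.card with hk
  have hi0 : i ≠ 0 := by
    rintro rfl
    simp at e
    exact hne e
  have hpow : (σ ^ k) ⟨(u, v), h⟩ = ⟨(u, v), h⟩ := by
    have := Equiv.Perm.pow_mod_card_support_cycleOf_self_apply σ k ⟨(u, v), h⟩
    rw [← hk] at this
    simpa using this.symm
  have hback : (σ ^ (k - i)) ⟨(u, w), h'⟩ = ⟨(u, v), h⟩ := by
    rw [← e, ← Equiv.Perm.mul_apply, ← pow_add, Nat.sub_add_cancel hi.le, hpow]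
  have hfst : ∀ (n : ℕ) (d : G.Dart), ((σ ^ n) d).toProd.1 = d.toProd.1 := by
    intro n
    induction n with
    | zero => intro d; rfl
    | succ n ih => intro d; rw [pow_succ, Equiv.Perm.mul_apply, ih, hT.rot.fst_eq]
  have hle : k ≤ deg G u := by
    have hmem : ∀ d ∈ (σ.cycleOf ⟨(u, v), h⟩).support, d.toProd.1 = u := by
      intro d hd
      have hsc := (Equiv.Perm.mem_support_cycleOf_iff.1 hd).1
      obtain ⟨j, -, hj⟩ := hsc.exists_pow_eq'
      rw [← hj, hfst]
    rw [deg, Nat.card_coe_set_eq, Set.ncard_eq_toFinset_card', hk]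
    apply Finset.card_le_card_of_injOn (fun d : G.Dart => d.toProd.2)
    · intro d hd
      have h1 := hmem d hd
      have h2 := d.adj
      rw [h1] at h2
      simpa using h2
    · intro d hd d' hd' hdd
      exact SimpleGraph.Dart.ext _ _ (Prod.ext ((hmem d hd).trans (hmem d' hd').symm) hdd)
  exact ⟨i, k - i, by omega, by omega, by omega, stepsTo_iff hT.rot u i _ _ e,
    stepsTo_iff hT.rot u _ _ _ hback⟩

theorem two_two [Fintype V] (hT : IsPlaneTriangulation G σ) {u v w : V}
    (h1 : StepsTo σ u 2 v w) (h2 : StepsTo σ v 2 w u) : ∃ z : V, deg G z = 3 := by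
  obtain ⟨x, hx1, _, hx2, rfl⟩ := h1
  obtain ⟨y, hy1, _, hy2, rfl⟩ := h2
  have r := @nextNbr_rot V G σ _ hT
  obtain rfl : x = y := nextNbr_inj hT.rot (r (r hx1)) hy2
  exact ⟨x, deg_three hT (r hx1) (r hy1) (r (r hx2))⟩

theorem two_three_three [Fintype V] (hT : IsPlaneTriangulation G σ) {u v w : V}
    (h1 : StepsTo σ u 2 v w) (h2 : StepsTo σ v 3 w u) (h3 : StepsTo σ w 3 u v) :
    ∃ z : V, deg G z = 3 := by
  obtain ⟨x, hx1, _, hx2, rfl⟩ := h1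
  obtain ⟨y, hy1, x', hy2, _, hy3, rfl⟩ := h2
  obtain ⟨x'', hw1, y', hw2, _, hw3, rfl⟩ := h3
  have r := @nextNbr_rot V G σ _ hT
  obtain rfl : x = x' := nextNbr_inj hT.rot (r (r hx1)) hy3
  obtain rfl : x = x'' := nextNbr_fun (r hx2) hw1
  obtain rfl : y = y' := nextNbr_inj hT.rot (r (r hy1)) hw3
  exact ⟨y, deg_three hT (r hy1) (r hw2) (r (r hy2))⟩

theorem side_bound [Fintype V] (hT : IsPlaneTriangulation G σ) {u v w : V}
    (hN : ¬ NextNbr σ u v w) (h3 : ¬ ∃ z : V, deg G z = 3) {a b c : ℕ}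
    (ha : 1 ≤ a) (hb : 1 ≤ b) (hc : 1 ≤ c)
    (h1 : StepsTo σ u a v w) (h2 : StepsTo σ v b w u) (h4 : StepsTo σ w c u v) :
    9 ≤ a + b + c := by
  have r := @nextNbr_rot V G σ _ hT
  have ha : a ≠ 1 := by
    rintro rfl
    obtain ⟨_, h, rfl⟩ := h1
    exact hN h
  have hb : b ≠ 1 := by
    rintro rfl
    obtain ⟨_, h, rfl⟩ := h2
    exact hN (r h)
  have hc : c ≠ 1 := by
    rintro rfl
    obtain ⟨_, h, rfl⟩ := h4
    exact hN (r (r h))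
  have k1 : ¬ (a = 2 ∧ b = 2) := by rintro ⟨rfl, rfl⟩; exact h3 (two_two hT h1 h2)
  have k2 : ¬ (b = 2 ∧ c = 2) := by rintro ⟨rfl, rfl⟩; exact h3 (two_two hT h2 h4)
  have k3 : ¬ (c = 2 ∧ a = 2) := by rintro ⟨rfl, rfl⟩; exact h3 (two_two hT h4 h1)
  have l1 : ¬ (a = 2 ∧ b = 3 ∧ c = 3) := by
    rintro ⟨rfl, rfl, rfl⟩; exact h3 (two_three_three hT h1 h2 h4)
  have l2 : ¬ (a = 3 ∧ b = 2 ∧ c = 3) := by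
    rintro ⟨rfl, rfl, rfl⟩; exact h3 (two_three_three hT h2 h4 h1)
  have l3 : ¬ (a = 3 ∧ b = 3 ∧ c = 2) := by
    rintro ⟨rfl, rfl, rfl⟩; exact h3 (two_three_three hT h4 h1 h2)
  omega

end helpers

theorem statement7 [Fintype V] (G : SimpleGraph V) (σ : Equiv.Perm G.Dart)
    (hT : IsPlaneTriangulation G σ) (u v w : V)
    (huv : G.Adj u v) (hvw : G.Adj v w) (hwu : G.Adj w u)
    (hnotface :
      ¬ ((facePerm σ ⟨(u, v), huv⟩ = ⟨(v, w), hvw⟩ ∧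
          facePerm σ ⟨(v, w), hvw⟩ = ⟨(w, u), hwu⟩ ∧
          facePerm σ ⟨(w, u), hwu⟩ = ⟨(u, v), huv⟩) ∨
         (facePerm σ ⟨(u, w), hwu.symm⟩ = ⟨(w, v), hvw.symm⟩ ∧
          facePerm σ ⟨(w, v), hvw.symm⟩ = ⟨(v, u), huv.symm⟩ ∧
          facePerm σ ⟨(v, u), huv.symm⟩ = ⟨(u, w), hwu.symm⟩))) :
    18 ≤ deg G u + deg G v + deg G w ∨ ∃ z : V, deg G z = 3 := by
  by_cases h3 : ∃ z : V, deg G z = 3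
  · exact Or.inr h3
  left
  have r := @nextNbr_rot V G σ _ hT
  have hN1 : ¬ NextNbr σ u v w := by
    intro h
    apply hnotface
    right
    obtain ⟨_, _, e1⟩ := (nextNbr_iff hT.rot).1 h
    obtain ⟨_, _, e2⟩ := (nextNbr_iff hT.rot).1 (r h)
    obtain ⟨_, _, e3⟩ := (nextNbr_iff hT.rot).1 (r (r h))
    exact ⟨e2, e3, e1⟩
  have hN2 : ¬ NextNbr σ u w v := by
    intro h
    apply hnotface
    left
    obtain ⟨_, _, e1⟩ := (nextNbr_iff hT.rot).1 h
    obtain ⟨_, _, e2⟩ := (nextNbr_iff hT.rot).1 (r h)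
    obtain ⟨_, _, e3⟩ := (nextNbr_iff hT.rot).1 (r (r h))
    exact ⟨e2, e3, e1⟩
  obtain ⟨a, a', ha, ha', hda, sa, sa'⟩ := exists_steps hT huv hwu.symm hvw.ne
  obtain ⟨b, b', hb, hb', hdb, sb, sb'⟩ := exists_steps hT hvw huv.symm hwu.ne
  obtain ⟨c, c', hc, hc', hdc, sc, sc'⟩ := exists_steps hT hwu hvw.symm huv.ne
  have s1 := side_bound hT hN1 h3 ha hb hc sa sb sc
  have s2 := side_bound hT hN2 h3 ha' hc' hb' sa' sc' sb'
  omega
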